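/- Under quasi-monotonicity (M) and local boundedness of f and g, if the family of supersolutions of the two-point boundary value problem ẋ = f(t,x,y), ẏ = g(t,x,y), x(0) = x̄, y(T) = ȳ is nonempty and uniformly bounded below, then the pointwise infimum of all supersolutions is a Carathéodory solution of the problem, and it is the minimal solution: it is componentwise ≤ every supersolution (hence every solution) at every time. -/

import Mathlib

open MeasureTheory Set

/-- Supersolution of the two-point boundary value problem (absolutely continuous
pair with boundary domination and the a.e. differential inequalities). -/
def IsSupersol {m n : ℕ} (T : ℝ)
    (f : ℝ → (Fin m → ℝ) → (Fin n → ℝ) → Fin m → ℝ)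
    (g : ℝ → (Fin m → ℝ) → (Fin n → ℝ) → Fin n → ℝ)
    (xbar : Fin m → ℝ) (ybar : Fin n → ℝ)
    (x : ℝ → Fin m → ℝ) (y : ℝ → Fin n → ℝ) : Prop :=
  ∃ x' : ℝ → Fin m → ℝ, ∃ y' : ℝ → Fin n → ℝ,
    (∀ i, IntervalIntegrable (fun t => x' t i) volume 0 T) ∧
    (∀ j, IntervalIntegrable (fun t => y' t j) volume 0 T) ∧
    (∀ t ∈ Icc (0:ℝ) T, ∀ i, x t i = x 0 i + ∫ s in (0:ℝ)..t, x' s i) ∧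
    (∀ t ∈ Icc (0:ℝ) T, ∀ j, y t j = y 0 j + ∫ s in (0:ℝ)..t, y' s j) ∧
    (∀ i, xbar i ≤ x 0 i) ∧ (∀ j, ybar j ≤ y T j) ∧
    (∀ᵐ t ∂volume, t ∈ Icc (0:ℝ) T →
      (∀ i, f t (x t) (y t) i ≤ x' t i) ∧ (∀ j, y' t j ≤ g t (x t) (y t) j))

open Filter Topology

/-- `u` is the primitive of the integrable function `u'` on `[0,T]`. -/
def PrimRep (T : ℝ) (u u' : ℝ → ℝ) : Prop :=
  IntervalIntegrable u' volume 0 T ∧ ∀ t ∈ Icc (0:ℝ) T, u t = u 0 + ∫ s in (0:ℝ)..t, u' s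

lemma PrimRep.of_ac {T : ℝ} (hT : 0 < T) {u : ℝ → ℝ} (h : AbsolutelyContinuousOnInterval u 0 T) :
    PrimRep T u (deriv u) := by
  refine ⟨h.intervalIntegrable_deriv, fun t ht => ?_⟩
  have h2 : AbsolutelyContinuousOnInterval u 0 t := h.mono (by
    rw [uIcc_of_le ht.1, uIcc_of_le hT.le]; exact Icc_subset_Icc_right ht.2)
  rw [h2.integral_deriv_eq_sub]; ring

lemma PrimRep.congr {T : ℝ} (hT : 0 < T) {u v u' v' : ℝ → ℝ} (h : PrimRep T u u')
    (huv : ∀ t ∈ Icc (0:ℝ) T, v t = u t) (h' : ∀ᵐ t, t ∈ Icc (0:ℝ) T → v' t = u' t) :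
    PrimRep T v v' := by
  have key : ∀ t ∈ Icc (0:ℝ) T, ∀ᵐ s, s ∈ uIoc 0 t → u' s = v' s := by
    intro t ht
    filter_upwards [h'] with s hs hst
    rw [uIoc_of_le ht.1] at hst
    exact (hs ⟨hst.1.le, hst.2.trans ht.2⟩).symm
  refine ⟨h.1.congr_ae ?_, fun t ht => ?_⟩
  · exact (ae_restrict_iff' measurableSet_uIoc).2 (key T ⟨hT.le, le_rfl⟩)
  · rw [huv t ht, huv 0 ⟨le_rfl, hT.le⟩, h.2 t ht]
    congr 1
    exact intervalIntegral.integral_congr_ae (key t ht)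

lemma PrimRep.ac {T : ℝ} (_hT : 0 < T) {u u' : ℝ → ℝ} (h : PrimRep T u u') :
    AbsolutelyContinuousOnInterval (fun t => u 0 + ∫ s in (0:ℝ)..t, u' s) 0 T := by
  have h1 := h.1.absolutelyContinuousOnInterval_intervalIntegral (c := 0) (by simp)
  have h2 : AbsolutelyContinuousOnInterval (fun _ : ℝ => u 0) 0 T :=
    (contDiff_const (𝕜 := ℝ) (n := 1)).contDiffOn.absolutelyContinuousOnInterval
  exact h2.add h1

lemma ae_Ioo {T : ℝ} : ∀ᵐ t : ℝ, t ∈ Icc (0:ℝ) T → t ∈ Ioo (0:ℝ) T := by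
  have h1 : ∀ᵐ t : ℝ, t ≠ 0 := by simp [ae_iff, measure_singleton]
  have h2 : ∀ᵐ t : ℝ, t ≠ T := by simp [ae_iff, measure_singleton]
  filter_upwards [h1, h2] with t h1 h2 ht
  exact ⟨lt_of_le_of_ne ht.1 (Ne.symm h1), lt_of_le_of_ne ht.2 h2⟩

lemma PrimRep.hasDeriv {T : ℝ} (hT : 0 < T) {u u' : ℝ → ℝ} (h : PrimRep T u u') :
    ∀ᵐ t, t ∈ Icc (0:ℝ) T → HasDerivAt u (u' t) t := by
  filter_upwards [h.1.ae_hasDerivAt_integral, ae_Ioo (T := T)] with t h1 h2 ht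
  rw [uIcc_of_le hT.le] at h1
  have h3 := (h1 ht 0 ⟨le_rfl, hT.le⟩).const_add (u 0)
  refine h3.congr_of_eventuallyEq ?_
  filter_upwards [isOpen_Ioo.mem_nhds (h2 ht)] with s hs
  exact h.2 s (Ioo_subset_Icc_self hs)

lemma PrimRep.continuousOn {T : ℝ} (hT : 0 < T) {u u' : ℝ → ℝ} (h : PrimRep T u u') :
    ContinuousOn u (Icc 0 T) := by
  have h1 := (h.ac hT).continuousOn
  rw [uIcc_of_le hT.le] at h1
  exact h1.congr fun t ht => h.2 t ht

lemma ac_min {a b : ℝ} {u v : ℝ → ℝ} (hu : AbsolutelyContinuousOnInterval u a b)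
    (hv : AbsolutelyContinuousOnInterval v a b) :
    AbsolutelyContinuousOnInterval (fun t => min (u t) (v t)) a b := by
  apply squeeze_zero (fun t ↦ ?_) (fun t ↦ ?_) (by simpa using Tendsto.add hu hv)
  · exact Finset.sum_nonneg (fun i hi ↦ by positivity)
  · rw [← Finset.sum_add_distrib]
    gcongr with i hi
    simp only [Real.dist_eq]
    refine (abs_min_sub_min_le_max _ _ _ _).trans ?_
    exact max_le (by linarith [abs_nonneg (v (t.2 i).1 - v (t.2 i).2)]) (by linarith [abs_nonneg (u (t.2 i).1 - u (t.2 i).2)])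

lemma hasDeriv_touch {u w : ℝ → ℝ} {a b t : ℝ} (hu : HasDerivAt u a t) (hw : HasDerivAt w b t)
    (hle : ∀ s, w s ≤ u s) (he : w t = u t) : b = a := by
  have h : IsLocalMax (fun s => w s - u s) t := by
    refine Eventually.of_forall fun s => ?_
    simp only [he, sub_self]; linarith [hle s]
  have := h.hasDerivAt_eq_zero (hw.sub hu)
  linarith

lemma PrimRep.min {T : ℝ} (hT : 0 < T) {u v u' v' : ℝ → ℝ} (hu : PrimRep T u u') (hv : PrimRep T v v') :
    ∃ w', PrimRep T (fun t => min (u t) (v t)) w' ∧ ∀ᵐ t, t ∈ Icc (0:ℝ) T →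
      (u t ≤ v t → w' t = u' t) ∧ (v t ≤ u t → w' t = v' t) := by
  have h1 := PrimRep.of_ac hT (ac_min (hu.ac hT) (hv.ac hT))
  have h2 : PrimRep T (fun t => Min.min (u t) (v t)) _ := h1.congr hT (fun t ht => by
    simp only [← hu.2 t ht, ← hv.2 t ht]) (Eventually.of_forall fun t _ => rfl)
  refine ⟨_, h2, ?_⟩
  filter_upwards [h2.hasDeriv hT, hu.hasDeriv hT, hv.hasDeriv hT] with t a b c ht
  refine ⟨fun h => hasDeriv_touch (b ht) (a ht) (fun s => min_le_left _ _) (min_eq_left h),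
    fun h => hasDeriv_touch (c ht) (a ht) (fun s => min_le_right _ _) (min_eq_right h)⟩

lemma PrimRep.reflect {T : ℝ} (hT : 0 < T) {u u' : ℝ → ℝ} (h : PrimRep T u u') :
    PrimRep T (fun t => u (T - t)) (fun t => - u' (T - t)) := by
  refine ⟨?_, fun t ht => ?_⟩
  · have := (h.1.comp_sub_left T).symm
    simp only [sub_zero, sub_self] at this
    exact this.neg
  · have e1 := h.2 (T - t) ⟨by linarith [ht.2], by linarith [ht.1]⟩
    have e2 := h.2 T ⟨hT.le, le_rfl⟩
    have hi1 : IntervalIntegrable u' volume 0 (T - t) := h.1.mono_set (by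
      rw [uIcc_of_le hT.le, uIcc_of_le (by linarith [ht.2])]
      exact Icc_subset_Icc_right (by linarith [ht.1]))
    have e3 := intervalIntegral.integral_interval_sub_left h.1 hi1
    simp only [intervalIntegral.integral_neg, sub_zero,
      intervalIntegral.integral_comp_sub_left (fun x => u' x)]
    linarith

lemma PrimRep.linODE {T : ℝ} (hT : 0 < T) (k a : ℝ) {φ : ℝ → ℝ} (hφ : IntervalIntegrable φ volume 0 T) :
    PrimRep T (fun t => Real.exp (-(k*t)) * (a + ∫ s in (0:ℝ)..t, Real.exp (k*s) * φ s))
      (fun t => φ t - k * (Real.exp (-(k*t)) * (a + ∫ s in (0:ℝ)..t, Real.exp (k*s) * φ s))) := by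
  have hi : IntervalIntegrable (fun s => Real.exp (k*s) * φ s) volume 0 T :=
    hφ.continuousOn_mul (by fun_prop)
  have hr : PrimRep T (fun t => a + ∫ s in (0:ℝ)..t, Real.exp (k*s) * φ s) (fun s => Real.exp (k*s) * φ s) :=
    ⟨hi, fun t ht => by simp⟩
  have hac := hr.ac hT
  have hE : AbsolutelyContinuousOnInterval (fun t : ℝ => Real.exp (-(k*t))) 0 T := by
    apply ContDiffOn.absolutelyContinuousOnInterval
    apply ContDiff.contDiffOn
    fun_prop
  have h1 := PrimRep.of_ac hT (hE.mul hac)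
  refine h1.congr hT (fun t ht => by simp) ?_
  filter_upwards [h1.hasDeriv hT, hr.hasDeriv hT] with t b c ht
  have d : HasDerivAt (fun t : ℝ => Real.exp (-(k*t))) (Real.exp (-(k*t)) * (-k)) t := by
    have : HasDerivAt (fun t : ℝ => -(k*t)) (-k) t := by
      simpa [neg_mul] using ((hasDerivAt_id t).const_mul (-k))
    exact this.exp
  have e := d.mul (c ht)
  have e2 : HasDerivAt (fun t => Real.exp (-(k*t)) * (a + ∫ s in (0:ℝ)..t, Real.exp (k*s) * φ s)) _ t := e
  have := (b ht).unique (by simpa [Pi.mul_def] using e2)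
  rw [this]
  have : Real.exp (-(k*t)) * (Real.exp (k*t) * φ t) = φ t := by
    rw [← mul_assoc, ← Real.exp_add]; simp
  rw [this]; ring

lemma mono_of_update {ι : Type*} [Fintype ι] [DecidableEq ι] (G : (ι → ℝ) → ℝ) (p q : ι → ℝ)
    (hpq : ∀ k, p k ≤ q k)
    (h : ∀ k, p k = q k ∨ ∀ x, Monotone (fun s => G (Function.update x k s))) : G p ≤ G q := by
  have key : ∀ s : Finset ι, G p ≤ G (s.piecewise q p) := by
    intro s
    induction s using Finset.induction_on with
    | empty => simp
    | insert a s ha ih =>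
      rw [Finset.piecewise_insert]
      refine ih.trans ?_
      have e : s.piecewise q p = Function.update (s.piecewise q p) a (p a) := by
        rw [eq_comm, Function.update_eq_self_iff]; simp [ha]
      rcases h a with h | h
      · rw [← h, ← e]
      · conv_lhs => rw [e]
        exact h _ (hpq a)
  simpa using key Finset.univ

structure Hyp {m n : ℕ} (T : ℝ)
    (f : ℝ → (Fin m → ℝ) → (Fin n → ℝ) → Fin m → ℝ)
    (g : ℝ → (Fin m → ℝ) → (Fin n → ℝ) → Fin n → ℝ) : Prop where
  hT : 0 < T
  hfx : ∀ t x y (i k : Fin m), k ≠ i →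
      Monotone (fun s => f t (Function.update x k s) y i)
  hfy : ∀ t x y (i : Fin m) (j : Fin n),
      Monotone (fun s => f t x (Function.update y j s) i)
  hgx : ∀ t x y (j : Fin n) (i : Fin m),
      Antitone (fun s => g t (Function.update x i s) y j)
  hgy : ∀ t x y (j k : Fin n), k ≠ j →
      Antitone (fun s => g t x (Function.update y k s) j)
  hfcont : ∀ t, Continuous fun p : (Fin m → ℝ) × (Fin n → ℝ) => f t p.1 p.2
  hgcont : ∀ t, Continuous fun p : (Fin m → ℝ) × (Fin n → ℝ) => g t p.1 p.2
  hfmeas : ∀ x y, Measurable fun t => f t x y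
  hgmeas : ∀ x y, Measurable fun t => g t x y
  hbdd : ∀ M > (0:ℝ), ∃ C, ∀ t ∈ Icc (0:ℝ) T, ∀ x y,
      (∀ i, |x i| ≤ M) → (∀ j, |y j| ≤ M) →
      (∀ i, |f t x y i| ≤ C) ∧ (∀ j, |g t x y j| ≤ C)

section
variable {m n : ℕ} {T : ℝ}
    {f : ℝ → (Fin m → ℝ) → (Fin n → ℝ) → Fin m → ℝ}
    {g : ℝ → (Fin m → ℝ) → (Fin n → ℝ) → Fin n → ℝ}
    {xbar : Fin m → ℝ} {ybar : Fin n → ℝ}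
    {x x₁ x₂ : ℝ → Fin m → ℝ} {y y₁ y₂ : ℝ → Fin n → ℝ}

lemma Hyp.swap (H : Hyp T f g) : Hyp T (fun t y x j => - g (T - t) x y j)
    (fun t y x i => - f (T - t) x y i) where
  hT := H.hT
  hfx t x y i k hk := (H.hgy (T - t) y x i k hk).neg
  hfy t x y i k := (H.hgx (T - t) y x i k).neg
  hgx t x y i k := (H.hfy (T - t) y x i k).neg
  hgy t x y i k hk := (H.hfx (T - t) y x i k hk).neg
  hfcont t := ((H.hgcont (T - t)).comp continuous_swap).neg
  hgcont t := ((H.hfcont (T - t)).comp continuous_swap).neg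
  hfmeas x y := ((H.hgmeas y x).comp (measurable_const.sub measurable_id)).neg
  hgmeas x y := ((H.hfmeas y x).comp (measurable_const.sub measurable_id)).neg
  hbdd M hM := by
    obtain ⟨C, hC⟩ := H.hbdd M hM
    refine ⟨C, fun t ht x y hx hy => ?_⟩
    have := hC (T - t) ⟨by linarith [ht.2], by linarith [ht.1]⟩ y x hy hx
    simpa using this.symm

lemma isSupersol_iff : IsSupersol T f g xbar ybar x y ↔
    ∃ x' : ℝ → Fin m → ℝ, ∃ y' : ℝ → Fin n → ℝ,
    (∀ i, PrimRep T (fun t => x t i) (fun t => x' t i)) ∧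
    (∀ j, PrimRep T (fun t => y t j) (fun t => y' t j)) ∧
    (∀ i, xbar i ≤ x 0 i) ∧ (∀ j, ybar j ≤ y T j) ∧
    (∀ᵐ t ∂volume, t ∈ Icc (0:ℝ) T →
      (∀ i, f t (x t) (y t) i ≤ x' t i) ∧ (∀ j, y' t j ≤ g t (x t) (y t) j)) := by
  constructor
  · rintro ⟨x', y', h1, h2, h3, h4, h5, h6, h7⟩
    exact ⟨x', y', fun i => ⟨h1 i, fun t ht => h3 t ht i⟩, fun i => ⟨h2 i, fun t ht => h4 t ht i⟩,
      h5, h6, h7⟩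
  · rintro ⟨x', y', h1, h2, h5, h6, h7⟩
    exact ⟨x', y', fun i => (h1 i).1, fun i => (h2 i).1, fun t ht i => (h1 i).2 t ht,
      fun t ht i => (h2 i).2 t ht, h5, h6, h7⟩

lemma IsSupersol.swap (H : Hyp T f g) (h : IsSupersol T f g xbar ybar x y) :
    IsSupersol T (fun t y x j => - g (T - t) x y j) (fun t y x i => - f (T - t) x y i) ybar xbar
      (fun t => y (T - t)) (fun t => x (T - t)) := by
  rw [isSupersol_iff] at h ⊢
  obtain ⟨x', y', h1, h2, h5, h6, h7⟩ := h
  refine ⟨fun t j => - y' (T - t) j, fun t i => - x' (T - t) i, fun j => (h2 j).reflect H.hT,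
    fun i => (h1 i).reflect H.hT, by simpa using h6, by simpa using h5, ?_⟩
  have := (volume.measurePreserving_sub_left T).quasiMeasurePreserving.ae h7
  filter_upwards [this] with t ht1 ht
  have := ht1 ⟨by linarith [ht.2], by linarith [ht.1]⟩
  exact ⟨fun j => neg_le_neg (this.2 j), fun i => neg_le_neg (this.1 i)⟩

lemma Hyp.f_mono (H : Hyp T f g) {t : ℝ} {p q : Fin m → ℝ} {r s : Fin n → ℝ} (i : Fin m)
    (hpq : ∀ k, p k ≤ q k) (hi : p i = q i) (hrs : ∀ k, r k ≤ s k) : f t p r i ≤ f t q s i := by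
  refine (mono_of_update (fun p => f t p r i) p q hpq fun k => ?_).trans
    (mono_of_update (fun r => f t q r i) r s hrs fun k => Or.inr fun z => H.hfy t q z i k)
  by_cases hk : k = i
  · subst hk; exact Or.inl hi
  · exact Or.inr fun z => H.hfx t z r i k hk

lemma Hyp.g_anti (H : Hyp T f g) {t : ℝ} {p q : Fin m → ℝ} {r s : Fin n → ℝ} (j : Fin n)
    (hpq : ∀ k, p k ≤ q k) (hj : r j = s j) (hrs : ∀ k, r k ≤ s k) : g t q s j ≤ g t p r j := by
  have := H.swap.f_mono (t := T - t) j hrs hj hpq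
  simpa using this

lemma IsSupersol.inf (H : Hyp T f g) (h1 : IsSupersol T f g xbar ybar x₁ y₁)
    (h2 : IsSupersol T f g xbar ybar x₂ y₂) :
    IsSupersol T f g xbar ybar (fun t i => min (x₁ t i) (x₂ t i))
      (fun t j => min (y₁ t j) (y₂ t j)) := by
  rw [isSupersol_iff] at h1 h2 ⊢
  obtain ⟨x1', y1', a1, a2, a3, a4, a5⟩ := h1
  obtain ⟨x2', y2', b1, b2, b3, b4, b5⟩ := h2
  choose x' hx' hx'2 using fun i => (a1 i).min H.hT (b1 i)
  choose y' hy' hy'2 using fun i => (a2 i).min H.hT (b2 i)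
  refine ⟨fun t i => x' i t, fun t j => y' j t, hx', hy', fun i => le_min (a3 i) (b3 i),
    fun i => le_min (a4 i) (b4 i), ?_⟩
  filter_upwards [a5, b5, ae_all_iff.2 hx'2, ae_all_iff.2 hy'2] with t c1 c2 c3 c4 ht
  constructor
  · intro i
    rcases le_total (x₁ t i) (x₂ t i) with hle | hle
    · rw [(c3 i ht).1 hle]
      exact (H.f_mono i (fun k => min_le_left _ _) (min_eq_left hle)
        (fun k => min_le_left _ _)).trans ((c1 ht).1 i)
    · rw [(c3 i ht).2 hle]
      exact (H.f_mono i (fun k => min_le_right _ _) (min_eq_right hle)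
        (fun k => min_le_right _ _)).trans ((c2 ht).1 i)
  · intro i
    rcases le_total (y₁ t i) (y₂ t i) with hle | hle
    · rw [(c4 i ht).1 hle]
      exact ((c1 ht).2 i).trans (H.g_anti i (fun k => min_le_left _ _) (min_eq_left hle)
        (fun k => min_le_left _ _))
    · rw [(c4 i ht).2 hle]
      exact ((c2 ht).2 i).trans (H.g_anti i (fun k => min_le_right _ _) (min_eq_right hle)
        (fun k => min_le_right _ _))

lemma IsSupersol.modify (H : Hyp T f g) (h1 : IsSupersol T f g xbar ybar x y) (i : Fin m)
    {Z Z' : ℝ → ℝ} (hZ : PrimRep T Z Z') (h0 : xbar i ≤ Z 0)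
    (hZ' : ∀ᵐ t, t ∈ Icc (0:ℝ) T → Z t ≤ x t i →
      f t (Function.update (x t) i (Z t)) (y t) i ≤ Z' t) :
    IsSupersol T f g xbar ybar (fun t => Function.update (x t) i (min (Z t) (x t i))) y := by
  rw [isSupersol_iff] at h1 ⊢
  obtain ⟨x', y', a1, a2, a3, a4, a5⟩ := h1
  obtain ⟨w', hw, hw2⟩ := hZ.min H.hT (a1 i)
  have hle : ∀ t k, Function.update (x t) i (min (Z t) (x t i)) k ≤ x t k := by
    intro t k
    by_cases hk : k = i
    · subst hk; simp
    · simp [hk]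
  refine ⟨fun t => Function.update (x' t) i (w' t), y', fun k => ?_, a2, fun k => ?_, a4, ?_⟩
  · by_cases hk : k = i
    · subst hk; simpa using hw
    · simpa [hk] using a1 k
  · by_cases hk : k = i
    · subst hk; simpa using ⟨h0, a3 k⟩
    · simpa [hk] using a3 k
  · filter_upwards [a5, hw2, hZ'] with t c1 c2 c3 ht
    refine ⟨fun k => ?_, fun j => ((c1 ht).2 j).trans (H.g_anti j (hle t) rfl fun _ => le_rfl)⟩
    by_cases hk : k = i
    · subst hk
      rw [Function.update_self]
      rcases le_total (Z t) (x t k) with hl | hl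
      · rw [(c2 ht).1 hl, min_eq_left hl]; exact c3 ht hl
      · rw [(c2 ht).2 hl, min_eq_right hl, Function.update_eq_self]; exact (c1 ht).1 k
    · rw [Function.update_of_ne hk]
      exact (H.f_mono k (hle t) (by simp [hk]) fun _ => le_rfl).trans ((c1 ht).1 k)

lemma IsSupersol.cont (H : Hyp T f g) (h : IsSupersol T f g xbar ybar x y) :
    (∀ i, ContinuousOn (fun t => x t i) (Icc 0 T)) ∧ (∀ j, ContinuousOn (fun t => y t j) (Icc 0 T)) := by
  rw [isSupersol_iff] at h
  obtain ⟨x', y', a1, a2, a3, a4, a5⟩ := h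
  exact ⟨fun i => (a1 i).continuousOn H.hT, fun i => (a2 i).continuousOn H.hT⟩

lemma IsSupersol.int_le (H : Hyp T f g) (h : IsSupersol T f g xbar ybar x y) (i : Fin m)
    {s t : ℝ} (hs : 0 ≤ s) (hst : s ≤ t) (htT : t ≤ T)  {φ : ℝ → ℝ} (hφ : IntervalIntegrable φ volume s t)
    (hle : ∀ τ ∈ Icc s t, φ τ ≤ f τ (x τ) (y τ) i) : x s i + ∫ τ in s..t, φ τ ≤ x t i := by
  rw [isSupersol_iff] at h
  obtain ⟨x', y', a1, a2, a3, a4, a5⟩ := h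
  have e1 := (a1 i).2 s ⟨hs, hst.trans htT⟩
  have e2 := (a1 i).2 t ⟨hs.trans hst, htT⟩
  have hi : ∀ r, 0 ≤ r → r ≤ T → IntervalIntegrable (fun t => x' t i) volume 0 r := fun r hr hr' =>
    (a1 i).1.mono_set (by
      rw [uIcc_of_le hr, uIcc_of_le H.hT.le]; exact Icc_subset_Icc_right hr')
  have h1 := hi s hs (hst.trans htT)
  have h2 := hi t (hs.trans hst) htT
  have e3 := intervalIntegral.integral_interval_sub_left h2 h1
  have : (∫ τ in s..t, φ τ) ≤ ∫ τ in s..t, x' τ i := by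
    refine intervalIntegral.integral_mono_ae_restrict hst hφ (h1.symm.trans h2) ?_
    refine (ae_restrict_iff' measurableSet_Icc).2 ?_
    filter_upwards [a5] with τ c hτ
    exact (hle τ hτ).trans ((c ⟨hs.trans hτ.1, hτ.2.trans htT⟩).1 i)
  simp only at e1 e2
  linarith
end

lemma modulus {K : Type*} [MetricSpace K] [CompactSpace K] [Nonempty K] (h : ℝ → K → ℝ)
    (hc : ∀ t, Continuous (h t)) (hm : ∀ p, Measurable (fun t => h t p)) (I : Set ℝ) (C : ℝ)
    (hC : ∀ t ∈ I, ∀ p, |h t p| ≤ C) :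
    ∃ e : ℕ → ℝ → ℝ, (∀ k, Measurable (e k)) ∧ (∀ k, ∀ t ∈ I, 0 ≤ e k t ∧ e k t ≤ 2 * C) ∧
      (∀ t ∈ I, Tendsto (fun k => e k t) atTop (𝓝 0)) ∧
      ∀ k : ℕ, ∀ t ∈ I, ∀ p q, h t p ≤ h t q + ((k:ℝ) + 1) * dist p q + e k t := by
  set d := TopologicalSpace.denseSeq K with hd
  have hdd : DenseRange d := TopologicalSpace.denseRange_denseSeq K
  let G : ℕ → ℝ → K × K → ℝ := fun k t a => h t a.1 - h t a.2 - ((k:ℝ) + 1) * dist a.1 a.2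
  have hGc : ∀ k t, Continuous (G k t) := fun k t => by
    have := hc t
    fun_prop
  have hG2 : ∀ k, ∀ t ∈ I, ∀ a, G k t a ≤ 2 * C := by
    intro k t ht a
    have h1 := abs_le.1 (hC t ht a.1)
    have h2 := abs_le.1 (hC t ht a.2)
    have h3 : 0 ≤ ((k:ℝ) + 1) * dist a.1 a.2 := by positivity
    simp only [G]; linarith
  let e : ℕ → ℝ → ℝ := fun k t => ⨆ a : ℕ × ℕ, G k t (d a.1, d a.2)
  have hbd : ∀ k, ∀ t ∈ I, BddAbove (range fun a : ℕ × ℕ => G k t (d a.1, d a.2)) := by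
    intro k t ht
    exact ⟨2 * C, by rintro _ ⟨a, rfl⟩; exact hG2 k t ht _⟩
  have hle : ∀ k, ∀ t ∈ I, ∀ a, G k t a ≤ e k t := by
    intro k t ht a
    have hdr : DenseRange (Prod.map d d) := hdd.prodMap hdd
    refine hdr.induction_on (p := fun a => G k t a ≤ e k t) a
      (isClosed_le (hGc k t) continuous_const) ?_
    intro a
    exact le_ciSup (hbd k t ht) a
  have h0 : ∀ k, ∀ t ∈ I, 0 ≤ e k t := by
    intro k t ht
    have := hle k t ht (d 0, d 0)
    simpa [G] using this
  refine ⟨e, fun k => ?_, fun k t ht => ⟨h0 k t ht, ciSup_le fun a => hG2 k t ht _⟩, ?_, ?_⟩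
  · refine Measurable.iSup fun a => ?_
    exact ((hm _).sub (hm _)).sub measurable_const
  · intro t ht
    have huc := CompactSpace.uniformContinuous_of_continuous (hc t)
    rw [Metric.tendsto_atTop]
    intro ε hε
    obtain ⟨δ, hδ, hδ2⟩ := Metric.uniformContinuous_iff.1 huc (ε/2) (by positivity)
    obtain ⟨N, hN⟩ := exists_nat_gt (2 * C / δ)
    refine ⟨N, fun k hk => ?_⟩
    rw [Real.dist_eq, sub_zero, abs_of_nonneg (h0 k t ht)]
    refine lt_of_le_of_lt (ciSup_le fun a => ?_) (half_lt_self hε)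
    rcases lt_or_ge (dist (d a.1) (d a.2)) δ with hlt | hge
    · have h1 := (abs_lt.1 (by simpa [Real.dist_eq] using hδ2 hlt)).2
      have h3 : 0 ≤ ((k:ℝ) + 1) * dist (d a.1) (d a.2) := by positivity
      simp only [G]; linarith
    · have h1 := abs_le.1 (hC t ht (d a.1))
      have h2 := abs_le.1 (hC t ht (d a.2))
      have h3 : (k + 1 : ℝ) * δ ≤ ((k:ℝ) + 1) * dist (d a.1) (d a.2) := by gcongr
      have h4 : 2 * C < N * δ := (div_lt_iff₀ hδ).1 hN
      have h5 : (N:ℝ) * δ ≤ (k + 1 : ℝ) * δ := by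
        have : (N:ℝ) ≤ k := by exact_mod_cast hk
        gcongr; linarith
      simp only [G]; linarith
  · intro k t ht p q
    have := hle k t ht (p, q)
    simp only [G] at this
    linarith

lemma exp_lower {T k a M : ℝ} (ha : -M ≤ a) {φ : ℝ → ℝ}
    (hφ : IntervalIntegrable φ volume 0 T) (hlow : ∀ t ∈ Icc (0:ℝ) T, -(k * M) ≤ φ t)
    {t : ℝ} (ht : t ∈ Icc (0:ℝ) T) :
    -M ≤ Real.exp (-(k*t)) * (a + ∫ s in (0:ℝ)..t, Real.exp (k*s) * φ s) := by
  have hφt : IntervalIntegrable φ volume 0 t := hφ.mono_set (by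
      rw [uIcc_of_le ht.1, uIcc_of_le (ht.1.trans ht.2)]; exact Icc_subset_Icc_right ht.2)
  have h1 : (∫ s in (0:ℝ)..t, Real.exp (k*s) * (-(k*M))) ≤ ∫ s in (0:ℝ)..t, Real.exp (k*s) * φ s := by
    refine intervalIntegral.integral_mono_on ht.1 (Continuous.intervalIntegrable (by fun_prop) _ _)
      (hφt.continuousOn_mul (by fun_prop)) fun s hs => ?_
    exact mul_le_mul_of_nonneg_left (hlow s ⟨hs.1, hs.2.trans ht.2⟩) (Real.exp_pos _).le
  have h2 : (∫ s in (0:ℝ)..t, Real.exp (k*s) * (-(k*M))) = - M * Real.exp (k*t) + M := by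
    rw [intervalIntegral.integral_eq_sub_of_hasDerivAt (f := fun s => -M * Real.exp (k*s))]
    · simp
    · intro s _
      have : HasDerivAt (fun s : ℝ => k*s) k s := by
        simpa using (hasDerivAt_id s).const_mul k
      convert! this.exp.const_mul (-M) using 1
      ring
    · exact Continuous.intervalIntegrable (by fun_prop) _ _
  have h3 : Real.exp (-(k*t)) * (-M * Real.exp (k*t)) = -M := by
    rw [mul_comm, mul_assoc, ← Real.exp_add]; simp
  rw [← h3]
  apply mul_le_mul_of_nonneg_left _ (Real.exp_pos _).le
  linarith

section
variable {m n : ℕ} {T : ℝ}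
    {f : ℝ → (Fin m → ℝ) → (Fin n → ℝ) → Fin m → ℝ}
    {g : ℝ → (Fin m → ℝ) → (Fin n → ℝ) → Fin n → ℝ}
    {xbar : Fin m → ℝ} {ybar : Fin n → ℝ}

lemma Hyp.f_aem (H : Hyp T f g) {μ : Measure ℝ} {x : ℝ → Fin m → ℝ} {y : ℝ → Fin n → ℝ}
    (hx : ∀ i, AEMeasurable (fun t => x t i) μ) (hy : ∀ j, AEMeasurable (fun t => y t j) μ)
    (i : Fin m) : AEMeasurable (fun t => f t (x t) (y t) i) μ := by
  have h1 : Measurable (Function.uncurry fun (p : (Fin m → ℝ) × (Fin n → ℝ)) t => f t p.1 p.2 i) :=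
    measurable_uncurry_of_continuous_of_measurable
      (fun t => (continuous_apply i).comp (H.hfcont t))
      (fun p => (measurable_pi_apply i).comp (H.hfmeas p.1 p.2))
  have h2 : AEMeasurable (fun t => ((x t, y t), t)) μ :=
    ((aemeasurable_pi_lambda _ hx).prodMk (aemeasurable_pi_lambda _ hy)).prodMk aemeasurable_id
  exact h1.comp_aemeasurable h2

lemma ii_of_bdd {T C : ℝ} {φ : ℝ → ℝ} (hm : AEMeasurable φ (volume.restrict (Icc 0 T)))
    (hC : ∀ t ∈ Icc (0:ℝ) T, |φ t| ≤ C) {t : ℝ} (ht : t ∈ Icc (0:ℝ) T) :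
    IntervalIntegrable φ volume 0 t := by
  rw [intervalIntegrable_iff_integrableOn_Icc_of_le ht.1]
  have : IntegrableOn φ (Icc 0 T) := by
    refine Integrable.of_bound hm.aestronglyMeasurable C ?_
    exact (ae_restrict_iff' measurableSet_Icc).2 (Eventually.of_forall hC)
  exact this.mono_set (Icc_subset_Icc_right ht.2)

lemma dct {T C : ℝ} {φ : ℕ → ℝ → ℝ} {ψ : ℝ → ℝ}
    (hm : ∀ n, AEMeasurable (φ n) (volume.restrict (Icc 0 T)))
    (hC : ∀ n, ∀ t ∈ Icc (0:ℝ) T, |φ n t| ≤ C)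
    (hl : ∀ t ∈ Icc (0:ℝ) T, Tendsto (fun n => φ n t) atTop (𝓝 (ψ t)))
    {t : ℝ} (ht : t ∈ Icc (0:ℝ) T) :
    Tendsto (fun n => ∫ s in (0:ℝ)..t, φ n s) atTop (𝓝 (∫ s in (0:ℝ)..t, ψ s)) := by
  have hsub : uIoc 0 t ⊆ Icc 0 T := by
    rw [uIoc_of_le ht.1]; exact fun s hs => ⟨hs.1.le, hs.2.trans ht.2⟩
  refine intervalIntegral.tendsto_integral_filter_of_dominated_convergence (fun _ => C) ?_ ?_ ?_ ?_
  · exact Eventually.of_forall fun n =>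
      ((hm n).mono_measure (Measure.restrict_mono hsub le_rfl)).aestronglyMeasurable
  · exact Eventually.of_forall fun n => Eventually.of_forall fun s hs => hC n s (hsub hs)
  · simp
  · exact Eventually.of_forall fun s hs => hl s (hsub hs)

lemma half (H : Hyp T f g) (X : ℕ → ℝ → Fin m → ℝ) (Y : ℕ → ℝ → Fin n → ℝ)
    (hS : ∀ k, IsSupersol T f g xbar ybar (X k) (Y k)) (M : ℝ)
    (hXM : ∀ k, ∀ t ∈ Icc (0:ℝ) T, ∀ i, |X k t i| ≤ M)
    (hYM : ∀ k, ∀ t ∈ Icc (0:ℝ) T, ∀ i, |Y k t i| ≤ M)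
    (xs : ℝ → Fin m → ℝ) (ys : ℝ → Fin n → ℝ)
    (hX : ∀ t ∈ Icc (0:ℝ) T, ∀ i, Tendsto (fun k => X k t i) atTop (𝓝 (xs t i)))
    (hY : ∀ t ∈ Icc (0:ℝ) T, ∀ i, Tendsto (fun k => Y k t i) atTop (𝓝 (ys t i)))
    (hmin : ∀ x y, IsSupersol T f g xbar ybar x y → ∀ t ∈ Icc (0:ℝ) T, ∀ i, xs t i ≤ x t i)
    (i : Fin m) :
    IntervalIntegrable (fun s => f s (xs s) (ys s) i) volume 0 T ∧
    ∀ t ∈ Icc (0:ℝ) T, xs t i = xbar i + ∫ s in (0:ℝ)..t, f s (xs s) (ys s) i := by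
  have hT := H.hT
  have h0T : (0:ℝ) ∈ Icc (0:ℝ) T := ⟨le_rfl, hT.le⟩
  have hTT : T ∈ Icc (0:ℝ) T := ⟨hT.le, le_rfl⟩
  have hM0 : 0 ≤ M := (abs_nonneg _).trans (hXM 0 0 h0T i)
  have hxsM : ∀ t ∈ Icc (0:ℝ) T, ∀ i, |xs t i| ≤ M := fun t ht i =>
    le_of_tendsto ((hX t ht i).abs) (Eventually.of_forall fun k => hXM k t ht i)
  have hysM : ∀ t ∈ Icc (0:ℝ) T, ∀ i, |ys t i| ≤ M := fun t ht i =>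
    le_of_tendsto ((hY t ht i).abs) (Eventually.of_forall fun k => hYM k t ht i)
  set μ := volume.restrict (Icc (0:ℝ) T) with hμ
  have hXm : ∀ k i, AEMeasurable (fun t => X k t i) μ := fun k i =>
    (((hS k).cont H).1 i).aemeasurable measurableSet_Icc
  have hYm : ∀ k i, AEMeasurable (fun t => Y k t i) μ := fun k i =>
    (((hS k).cont H).2 i).aemeasurable measurableSet_Icc
  have hxsm : ∀ i, AEMeasurable (fun t => xs t i) μ := fun i =>
    aemeasurable_of_tendsto_metrizable_ae atTop (fun k => hXm k i)
      ((ae_restrict_iff' measurableSet_Icc).2 (Eventually.of_forall fun t ht => hX t ht i))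
  have hysm : ∀ i, AEMeasurable (fun t => ys t i) μ := fun i =>
    aemeasurable_of_tendsto_metrizable_ae atTop (fun k => hYm k i)
      ((ae_restrict_iff' measurableSet_Icc).2 (Eventually.of_forall fun t ht => hY t ht i))
  obtain ⟨C, hC⟩ := H.hbdd (M+1) (by linarith)
  have hfM : ∀ t ∈ Icc (0:ℝ) T, ∀ x y, (∀ i, |x i| ≤ M) → (∀ j, |y j| ≤ M) → |f t x y i| ≤ C :=
    fun t ht x y hx hy => (hC t ht x y (fun i => (hx i).trans (by linarith))
      (fun i => (hy i).trans (by linarith))).1 i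
  have hFm := fun k => H.f_aem (hXm k) (hYm k) i
  have hFsm := H.f_aem hxsm hysm i
  have hFb : ∀ k, ∀ t ∈ Icc (0:ℝ) T, |f t (X k t) (Y k t) i| ≤ C := fun k t ht =>
    hfM t ht _ _ (hXM k t ht) (hYM k t ht)
  have hFsb : ∀ t ∈ Icc (0:ℝ) T, |f t (xs t) (ys t) i| ≤ C := fun t ht =>
    hfM t ht _ _ (hxsM t ht) (hysM t ht)
  have hC0 : 0 ≤ C := (abs_nonneg _).trans (hFsb 0 h0T)
  have hFl : ∀ t ∈ Icc (0:ℝ) T, Tendsto (fun k => f t (X k t) (Y k t) i) atTop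
      (𝓝 (f t (xs t) (ys t) i)) := by
    intro t ht
    have h1 : Tendsto (fun k => (X k t, Y k t)) atTop (𝓝 (xs t, ys t)) :=
      (tendsto_pi_nhds.2 (hX t ht)).prodMk_nhds (tendsto_pi_nhds.2 (hY t ht))
    exact (((continuous_apply i).comp (H.hfcont t)).tendsto (xs t, ys t)).comp h1
  refine ⟨ii_of_bdd hFsm hFsb hTT, fun t ht => le_antisymm ?_ ?_⟩
  swap
  · -- lower bound
    have h1 := (dct hFm hFb hFl ht).const_add (xbar i)
    refine le_of_tendsto_of_tendsto' h1 (hX t ht i) fun k => ?_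
    have h2 := (hS k).int_le H i le_rfl ht.1 ht.2 (ii_of_bdd (hFm k) (hFb k) ht) fun _ _ => le_rfl
    obtain ⟨_, _, _, _, _, _, h3, _⟩ := hS k
    linarith [h3 i]
  · -- upper bound
    set M2 : ℝ := M + C + |xbar i| + 1 with hM2
    have hM2M : M ≤ M2 := by have := abs_nonneg (xbar i); linarith
    obtain ⟨C2, hC2⟩ := H.hbdd M2 (by have := abs_nonneg (xbar i); linarith)
    let K : Set ((Fin m → ℝ) × (Fin n → ℝ)) := Icc (fun _ => -M2) (fun _ => M2) ×ˢ
      Icc (fun _ => -M2) (fun _ => M2)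
    have hK : IsCompact K := isCompact_Icc.prod isCompact_Icc
    have hKmem : ∀ x y, (∀ i, |x i| ≤ M2) → (∀ i, |y i| ≤ M2) → (x, y) ∈ K := by
      intro x y hx hy
      exact ⟨⟨fun i => (abs_le.1 (hx i)).1, fun i => (abs_le.1 (hx i)).2⟩,
        ⟨fun i => (abs_le.1 (hy i)).1, fun i => (abs_le.1 (hy i)).2⟩⟩
    have hKmem2 : ∀ p : K, (∀ i, |p.1.1 i| ≤ M2) ∧ (∀ i, |p.1.2 i| ≤ M2) := by
      rintro ⟨p, hp⟩
      exact ⟨fun i => abs_le.2 ⟨hp.1.1 i, hp.1.2 i⟩, fun i => abs_le.2 ⟨hp.2.1 i, hp.2.2 i⟩⟩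
    have : CompactSpace K := isCompact_iff_compactSpace.1 hK
    have : Nonempty K := ⟨⟨(xs 0, ys 0), hKmem _ _ (fun i => (hxsM 0 h0T i).trans hM2M)
      (fun i => (hysM 0 h0T i).trans hM2M)⟩⟩
    obtain ⟨e, hem, heb, hel, hemod⟩ := modulus (K := K) (fun t p => f t p.1.1 p.1.2 i)
      (fun t => (((continuous_apply i).comp (H.hfcont t)).comp continuous_subtype_val))
      (fun p => (measurable_pi_apply i).comp (H.hfmeas p.1.1 p.1.2)) (Icc 0 T) C2
      (fun t ht p => (hC2 t ht _ _ (hKmem2 p).1 (hKmem2 p).2).1 i)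
    have heb' : ∀ k, ∀ t ∈ Icc (0:ℝ) T, |e k t| ≤ 2 * C2 := fun k t ht => by
      rw [abs_of_nonneg (heb k t ht).1]; exact (heb k t ht).2
    have hem' : ∀ k, AEMeasurable (e k) μ := fun k => (hem k).aemeasurable
    have key : ∀ k : ℕ, xs t i ≤ xbar i + ((∫ s in (0:ℝ)..t, e k s) +
        ∫ s in (0:ℝ)..t, f s (xs s) (ys s) i) := by
      intro k
      set κ : ℝ := (k:ℝ) + 1 with hκ
      have hκ1 : 1 ≤ κ := by rw [hκ]; linarith [Nat.cast_nonneg (α := ℝ) k]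
      let φ : ℕ → ℝ → ℝ := fun l s => e k s + f s (X l s) (Y l s) i + κ * X l s i
      let ψ : ℝ → ℝ := fun s => e k s + f s (xs s) (ys s) i + κ * xs s i
      let Z : (ℝ → ℝ) → ℝ → ℝ := fun φ t =>
        Real.exp (-(κ*t)) * (xbar i + ∫ s in (0:ℝ)..t, Real.exp (κ*s) * φ s)
      have hφm : ∀ l, AEMeasurable (φ l) μ := fun l =>
        ((hem' k).add (hFm l)).add ((hXm l i).const_mul κ)
      have hψm : AEMeasurable ψ μ := ((hem' k).add hFsm).add ((hxsm i).const_mul κ)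
      have bnd : ∀ a b c : ℝ, |a| ≤ 2 * C2 → |b| ≤ C → |c| ≤ M → |a + b + κ * c| ≤ 2*C2 + C + κ * M := by
        intro a b c ha hb hc
        refine (abs_add_three _ _ _).trans ?_
        rw [abs_mul, abs_of_nonneg (by linarith : (0:ℝ) ≤ κ)]
        gcongr
      have hφb : ∀ l, ∀ s ∈ Icc (0:ℝ) T, |φ l s| ≤ 2*C2 + C + κ * M := fun l s hs =>
        bnd _ _ _ (heb' k s hs) (hFb l s hs) (hXM l s hs i)
      have hψb : ∀ s ∈ Icc (0:ℝ) T, |ψ s| ≤ 2*C2 + C + κ * M := fun s hs =>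
        bnd _ _ _ (heb' k s hs) (hFsb s hs) (hxsM s hs i)
      have hφi := fun l => ii_of_bdd (hφm l) (hφb l) hTT
      have hψi := ii_of_bdd hψm hψb hTT
      have hφl : ∀ s ∈ Icc (0:ℝ) T, Tendsto (fun l => φ l s) atTop (𝓝 (ψ s)) := fun s hs =>
        ((hFl s hs).const_add (e k s)).add ((hX s hs i).const_mul κ)
      have hZle : ∀ l, ∀ s ∈ Icc (0:ℝ) T, xs s i ≤ Z (φ l) s := by
        intro l
        have hrep : PrimRep T (Z (φ l)) (fun t => φ l t - κ * Z (φ l) t) :=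
          PrimRep.linODE hT κ (xbar i) (hφi l)
        have hlow : ∀ s ∈ Icc (0:ℝ) T, -M2 ≤ Z (φ l) s := by
          intro s hs
          refine exp_lower (T := T) ?_ (hφi l) ?_ hs
          · linarith [neg_abs_le (xbar i)]
          · intro r hr
            have h1 := (abs_le.1 (hFb l r hr)).1
            have h2 := (abs_le.1 (hXM l r hr i)).1
            have h3 := (heb k r hr).1
            have h4 : κ * (-M) ≤ κ * X l r i := by gcongr
            have h5 : C ≤ κ * C := by nlinarith
            have h6 : κ * (M + C) ≤ κ * M2 := by
              gcongr; linarith [abs_nonneg (xbar i)]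
            simp only [φ]; linarith
        have hsup := (hS l).modify H i hrep (by simp [Z]) (Eventually.of_forall (by
          intro s hs hle
          have hxl : ∀ j, |X l s j| ≤ M2 := fun j => (hXM l s hs j).trans hM2M
          have hyl : ∀ j, |Y l s j| ≤ M2 := fun j => (hYM l s hs j).trans hM2M
          have hxu : ∀ j, |Function.update (X l s) i (Z (φ l) s) j| ≤ M2 := by
            intro j
            by_cases hj : j = i
            · subst hj
              rw [Function.update_self]
              exact abs_le.2 ⟨hlow s hs, hle.trans (abs_le.1 (hxl j)).2⟩
            · rw [Function.update_of_ne hj]; exact hxl j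
          have h1 := hemod k s hs ⟨_, hKmem _ _ hxu hyl⟩ ⟨_, hKmem _ _ hxl hyl⟩
          have h2 : dist (Function.update (X l s) i (Z (φ l) s), Y l s) (X l s, Y l s)
              ≤ X l s i - Z (φ l) s := by
            rw [Prod.dist_eq, dist_self]
            refine max_le ?_ (by linarith)
            rw [dist_pi_le_iff (by linarith)]
            intro j
            dsimp only
            by_cases hj : j = i
            · subst hj
              rw [Function.update_self, Real.dist_eq, abs_sub_comm, abs_of_nonneg (by linarith)]
            · rw [Function.update_of_ne hj, dist_self]; linarith
          have h3 := mul_le_mul_of_nonneg_left h2 (by linarith : 0 ≤ κ)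
          simp only [Subtype.dist_eq] at h1
          rw [← hκ] at h1
          simp only [φ] at h1 h3 ⊢
          linarith))
        intro s hs
        have := hmin _ _ hsup s hs i
        rw [Function.update_self] at this
        exact this.trans (min_le_left _ _)
      have hZl : ∀ s ∈ Icc (0:ℝ) T, Tendsto (fun l => Z (φ l) s) atTop (𝓝 (Z ψ s)) := by
        intro s hs
        refine Tendsto.const_mul _ (Tendsto.const_add _ ?_)
        have hem2 : AEMeasurable (fun s => Real.exp (κ * s)) μ :=
          (by fun_prop : Measurable fun s => Real.exp (κ * s)).aemeasurable
        refine dct (C := Real.exp (κ * T) * (2*C2 + C + κ * M)) (fun l => hem2.mul (hφm l)) ?_ ?_ hs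
        · intro l r hr
          rw [Pi.mul_apply, abs_mul, abs_of_pos (Real.exp_pos _)]
          have : κ * r ≤ κ * T := by gcongr; exact hr.2
          exact mul_le_mul (Real.exp_le_exp.2 this) (hφb l r hr) (abs_nonneg _) (Real.exp_pos _).le
        · intro r hr
          exact (hφl r hr).const_mul _
      have hZs : ∀ s ∈ Icc (0:ℝ) T, xs s i ≤ Z ψ s := fun s hs =>
        ge_of_tendsto' (hZl s hs) fun l => hZle l s hs
      have hrep : PrimRep T (Z ψ) (fun t => ψ t - κ * Z ψ t) := PrimRep.linODE hT κ (xbar i) hψi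
      refine (hZs t ht).trans ?_
      have hei := ii_of_bdd (hem' k) (heb' k) ht
      have hfi := ii_of_bdd hFsm hFsb ht
      rw [hrep.2 t ht, ← intervalIntegral.integral_add hei hfi]
      have hZ0 : Z ψ 0 = xbar i := by simp [Z]
      rw [hZ0]
      gcongr
      refine intervalIntegral.integral_mono_on ht.1 (hrep.1.mono_set ?_) (hei.add hfi) ?_
      · rw [uIcc_of_le ht.1, uIcc_of_le hT.le]; exact Icc_subset_Icc_right ht.2
      · intro s hs
        have h1 := hZs s ⟨hs.1, hs.2.trans ht.2⟩
        have : κ * xs s i ≤ κ * Z ψ s := by gcongr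
        simp only [ψ] at this ⊢
        linarith
    have hlim : Tendsto (fun k => ∫ s in (0:ℝ)..t, e k s) atTop (𝓝 (∫ s in (0:ℝ)..t, (0:ℝ))) :=
      dct hem' heb' hel ht
    have := ge_of_tendsto' ((hlim.add_const _).const_add (xbar i)) key
    simpa using this
end

lemma dense_conv {T L : ℝ} (h : ℝ → ℝ)
    (hm : MonotoneOn (fun t => h t + L * t) (Icc 0 T)) :
    ∃ D : Set ℝ, D.Countable ∧ D ⊆ Icc 0 T ∧ ∀ v : ℕ → ℝ → ℝ,
      (∀ k, MonotoneOn (fun t => v k t + L * t) (Icc 0 T)) →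
      (∀ k, ∀ t ∈ Icc (0:ℝ) T, h t ≤ v k t) →
      (∀ d ∈ D, Tendsto (fun k => v k d) atTop (𝓝 (h d))) →
      ∀ t ∈ Icc (0:ℝ) T, Tendsto (fun k => v k t) atTop (𝓝 (h t)) := by
  set w : ℝ → ℝ := fun t => h t + L * t with hw
  refine ⟨(({T} ∪ range ((↑) : ℚ → ℝ)) ∩ Icc 0 T) ∪ {t ∈ Icc 0 T | ¬ ContinuousWithinAt w (Icc 0 T) t},
    ?_, ?_, ?_⟩
  · exact ((((countable_singleton T).union (countable_range _)).mono inter_subset_left)).union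
      hm.countable_not_continuousWithinAt
  · rintro t (ht | ht)
    · exact ht.2
    · exact ht.1
  intro v hv hle hd t ht
  by_cases hc : ContinuousWithinAt w (Icc 0 T) t
  swap
  · exact hd t (Or.inr ⟨ht, hc⟩)
  rcases eq_or_lt_of_le ht.2 with htT | htT
  · exact hd t (Or.inl ⟨Or.inl htT, ht⟩)
  rw [Metric.tendsto_atTop]
  intro ε hε
  obtain ⟨δ, hδ, hδ2⟩ := Metric.continuousWithinAt_iff.1 hc (ε/2) (by positivity)
  obtain ⟨q, hq1, hq2⟩ := exists_rat_btwn (lt_min htT (by linarith : t < t + δ))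
  have hqI : (q:ℝ) ∈ Icc (0:ℝ) T := ⟨ht.1.trans hq1.le, (hq2.trans_le (min_le_left _ _)).le⟩
  have hq3 : (q:ℝ) < t + δ := hq2.trans_le (min_le_right _ _)
  have h1 := hδ2 hqI (by rw [Real.dist_eq, abs_lt]; constructor <;> linarith)
  rw [Real.dist_eq] at h1
  have h1 := (abs_lt.1 h1).2
  obtain ⟨N, hN⟩ := Metric.tendsto_atTop.1 (hd q (Or.inl ⟨Or.inr ⟨q, rfl⟩, hqI⟩)) (ε/2) (by positivity)
  refine ⟨N, fun k hk => ?_⟩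
  have h2 := hN k hk
  rw [Real.dist_eq] at h2
  have h2 := (abs_lt.1 h2).2
  have h3 := hv k ht hqI hq1.le
  have h4 := hle k t ht
  simp only [hw] at h1 h3
  rw [Real.dist_eq, abs_of_nonneg (by linarith)]
  linarith

section
variable {m n : ℕ} {T : ℝ}
    {f : ℝ → (Fin m → ℝ) → (Fin n → ℝ) → Fin m → ℝ}
    {g : ℝ → (Fin m → ℝ) → (Fin n → ℝ) → Fin n → ℝ}
    {xbar : Fin m → ℝ} {ybar : Fin n → ℝ}

lemma cont_bdd {d : ℕ} {x : ℝ → Fin d → ℝ} (h : ∀ i, ContinuousOn (fun t => x t i) (Icc 0 T)) :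
    ∃ B, ∀ t ∈ Icc (0:ℝ) T, ∀ i, x t i ≤ B := by
  choose b hb using fun i => (isCompact_Icc.image_of_continuousOn (h i)).bddAbove
  obtain ⟨B, hB⟩ := (finite_range b).bddAbove
  exact ⟨B, fun t ht i => (hb i ⟨t, ht, rfl⟩).trans (hB ⟨i, rfl⟩)⟩

lemma sup_bdd (H : Hyp T f g) {x₀ : ℝ → Fin m → ℝ} {y₀ : ℝ → Fin n → ℝ}
    (h0 : IsSupersol T f g xbar ybar x₀ y₀)
    (hbelow : ∃ C, ∀ x y, IsSupersol T f g xbar ybar x y →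
      ∀ t ∈ Icc (0:ℝ) T, (∀ i, C ≤ x t i) ∧ (∀ j, C ≤ y t j)) :
    ∃ M > 0, ∀ x y, IsSupersol T f g xbar ybar x y → (∀ t ∈ Icc (0:ℝ) T, ∀ i, x t i ≤ x₀ t i) →
      (∀ t ∈ Icc (0:ℝ) T, ∀ i, y t i ≤ y₀ t i) →
      (∀ t ∈ Icc (0:ℝ) T, ∀ i, |x t i| ≤ M) ∧ (∀ t ∈ Icc (0:ℝ) T, ∀ i, |y t i| ≤ M) := by
  obtain ⟨C, hC⟩ := hbelow
  obtain ⟨B1, hB1⟩ := cont_bdd (h0.cont H).1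
  obtain ⟨B2, hB2⟩ := cont_bdd (h0.cont H).2
  refine ⟨|C| + |B1| + |B2| + 1, by positivity, fun x y h hx hy => ⟨fun t ht i => ?_, fun t ht i => ?_⟩⟩
  · have := (hC x y h t ht).1 i
    have := hB1 t ht i
    have := hx t ht i
    rw [abs_le]
    constructor <;> linarith [neg_abs_le C, le_abs_self B1, abs_nonneg C, abs_nonneg B1, abs_nonneg B2]
  · have := (hC x y h t ht).2 i
    have := hB2 t ht i
    have := hy t ht i
    rw [abs_le]
    constructor <;> linarith [neg_abs_le C, le_abs_self B2, abs_nonneg C, abs_nonneg B1, abs_nonneg B2]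

lemma seqhalf (H : Hyp T f g) {x₀ : ℝ → Fin m → ℝ} {y₀ : ℝ → Fin n → ℝ}
    (h0 : IsSupersol T f g xbar ybar x₀ y₀)
    (hbelow : ∃ C, ∀ x y, IsSupersol T f g xbar ybar x y →
      ∀ t ∈ Icc (0:ℝ) T, (∀ i, C ≤ x t i) ∧ (∀ j, C ≤ y t j))
    {xs : ℝ → Fin m → ℝ}
    (hmin : ∀ x y, IsSupersol T f g xbar ybar x y → ∀ t ∈ Icc (0:ℝ) T, ∀ i, xs t i ≤ x t i)
    (hap : ∀ t ∈ Icc (0:ℝ) T, ∀ i, ∀ ε > 0, ∃ x y, IsSupersol T f g xbar ybar x y ∧ x t i < xs t i + ε) :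
    ∃ (U : ℕ → ℝ → Fin m → ℝ) (W : ℕ → ℝ → Fin n → ℝ), (∀ k, IsSupersol T f g xbar ybar (U k) (W k)) ∧
      ∀ (V : ℕ → ℝ → Fin m → ℝ) (V' : ℕ → ℝ → Fin n → ℝ),
        (∀ l, IsSupersol T f g xbar ybar (V l) (V' l)) →
        (∀ l, ∀ t ∈ Icc (0:ℝ) T, ∀ i, V l t i ≤ x₀ t i) →
        (∀ l, ∀ t ∈ Icc (0:ℝ) T, ∀ i, V' l t i ≤ y₀ t i) →
        (∀ l k, k ≤ l → ∀ t ∈ Icc (0:ℝ) T, ∀ i, V l t i ≤ U k t i) →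
        ∀ t ∈ Icc (0:ℝ) T, ∀ i, Tendsto (fun l => V l t i) atTop (𝓝 (xs t i)) := by
  obtain ⟨M, hM0, hM⟩ := sup_bdd H h0 hbelow
  obtain ⟨L', hL'⟩ := H.hbdd M hM0
  set L := |L'| with hLdef
  have hL : 0 ≤ L := abs_nonneg _
  have hmono : ∀ x y, IsSupersol T f g xbar ybar x y → (∀ t ∈ Icc (0:ℝ) T, ∀ i, x t i ≤ x₀ t i) →
      (∀ t ∈ Icc (0:ℝ) T, ∀ i, y t i ≤ y₀ t i) → ∀ i, MonotoneOn (fun t => x t i + L * t) (Icc 0 T) := by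
    intro x y h hx hy i s hs t ht hst
    obtain ⟨b1, b2⟩ := hM x y h hx hy
    have h1 := h.int_le H i hs.1 hst ht.2 (φ := fun _ => -L) (by simp) (by
      intro τ hτ
      have hτ' : τ ∈ Icc (0:ℝ) T := ⟨hs.1.trans hτ.1, hτ.2.trans ht.2⟩
      have := (abs_le.1 ((hL' τ hτ' _ _ (b1 τ hτ') (b2 τ hτ')).1 i)).1
      linarith [le_abs_self L'])
    simp only [intervalIntegral.integral_const, smul_eq_mul] at h1
    simp only
    nlinarith
  have hxsmono : ∀ i, MonotoneOn (fun t => xs t i + L * t) (Icc 0 T) := by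
    intro i s hs t ht hst
    refine le_of_forall_pos_le_add fun ε hε => ?_
    obtain ⟨x, y, h, hlt⟩ := hap t ht i ε hε
    have h2 := h.inf H h0
    have h3 := hmono _ _ h2 (fun t _ i => min_le_right _ _) (fun t _ i => min_le_right _ _) i hs ht hst
    have h4 := hmin _ _ h2 s hs i
    have h5 := min_le_left (x t i) (x₀ t i)
    simp only at h3 h4 ⊢
    linarith
  choose D hDc hDI hD using fun i => dense_conv (fun t => xs t i) (hxsmono i)
  have hc : ∀ a : Option (Σ i : Fin m, D i × ℕ), ∃ p : (ℝ → Fin m → ℝ) × (ℝ → Fin n → ℝ),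
      IsSupersol T f g xbar ybar p.1 p.2 ∧
      ∀ i d k, a = some ⟨i, d, k⟩ → p.1 d i < xs d i + 1 / ((k:ℝ) + 1) := by
    rintro (_ | ⟨i, d, k⟩)
    · exact ⟨(x₀, y₀), h0, by simp⟩
    · obtain ⟨x, y, h, hlt⟩ := hap d (hDI i d.2) i (1 / ((k:ℝ) + 1)) (by positivity)
      refine ⟨(x, y), h, ?_⟩
      intro i' d' k' he
      cases he
      exact hlt
  choose p hp hp2 using hc
  have : ∀ i, Countable (D i) := fun i => (hDc i).to_subtype
  obtain ⟨en, hen⟩ := exists_surjective_nat (Option (Σ i : Fin m, D i × ℕ))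
  refine ⟨fun k => (p (en k)).1, fun k => (p (en k)).2, fun k => hp _, ?_⟩
  intro V V' hV hVx hVy hVU t ht i
  refine hD i (fun l t => V l t i) (fun l => hmono _ _ (hV l) (hVx l) (hVy l) i)
    (fun l t ht => hmin _ _ (hV l) t ht i) ?_ t ht
  intro d hd
  rw [Metric.tendsto_atTop]
  intro ε hε
  obtain ⟨k, hk⟩ := exists_nat_one_div_lt hε
  obtain ⟨N, hN⟩ := hen (some ⟨i, ⟨d, hd⟩, k⟩)
  refine ⟨N, fun l hl => ?_⟩
  have h1 := hVU l N hl d (hDI i hd) i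
  have h2 := hp2 _ _ _ _ hN
  have h3 := hmin _ _ (hV l) d (hDI i hd) i
  simp only at h1 h2
  rw [Real.dist_eq, abs_of_nonneg (by linarith)]
  linarith

end

section
variable {m n : ℕ} {T : ℝ}
    {f : ℝ → (Fin m → ℝ) → (Fin n → ℝ) → Fin m → ℝ}
    {g : ℝ → (Fin m → ℝ) → (Fin n → ℝ) → Fin n → ℝ}
    {xbar : Fin m → ℝ} {ybar : Fin n → ℝ}

lemma IsSupersol.unswap (H : Hyp T f g) {u : ℝ → Fin n → ℝ} {w : ℝ → Fin m → ℝ}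
    (h : IsSupersol T (fun t y x j => - g (T - t) x y j) (fun t y x i => - f (T - t) x y i) ybar xbar
      u w) : IsSupersol T f g xbar ybar (fun t => w (T - t)) (fun t => u (T - t)) := by
  have := h.swap H.swap
  simpa using this

/-- Iterated componentwise minimum of a sequence of functions. -/
def itMin {d : ℕ} (a : ℝ → Fin d → ℝ) (u : ℕ → ℝ → Fin d → ℝ) : ℕ → ℝ → Fin d → ℝ
  | 0 => a
  | k + 1 => fun t i => min (itMin a u k t i) (u k t i)

lemma itMin_le_base {d : ℕ} (a : ℝ → Fin d → ℝ) (u : ℕ → ℝ → Fin d → ℝ) (l : ℕ) (t : ℝ) (i : Fin d) :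
    itMin a u l t i ≤ a t i := by
  induction l with
  | zero => exact le_rfl
  | succ l ih => exact (min_le_left _ _).trans ih

lemma itMin_le {d : ℕ} (a : ℝ → Fin d → ℝ) (u : ℕ → ℝ → Fin d → ℝ) (l k : ℕ) (hk : k < l)
    (t : ℝ) (i : Fin d) : itMin a u l t i ≤ u k t i := by
  induction l with
  | zero => omega
  | succ l ih =>
    rcases Nat.lt_succ_iff_lt_or_eq.1 hk with h | h
    · exact (min_le_left _ _).trans (ih h)
    · subst h; exact min_le_right _ _

lemma itMin_sup (H : Hyp T f g) {x₀ : ℝ → Fin m → ℝ} {y₀ : ℝ → Fin n → ℝ}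
    (h0 : IsSupersol T f g xbar ybar x₀ y₀) {U : ℕ → ℝ → Fin m → ℝ} {W : ℕ → ℝ → Fin n → ℝ}
    (h : ∀ k, IsSupersol T f g xbar ybar (U k) (W k)) (l : ℕ) :
    IsSupersol T f g xbar ybar (itMin x₀ U l) (itMin y₀ W l) := by
  induction l with
  | zero => exact h0
  | succ l ih => exact ih.inf H (h l)

end

/-- under quasi-monotonicity (M), continuity in `(x,y)`,
measurability in `t` and local boundedness of `f,g`, if the family of
supersolutions is nonempty and uniformly bounded below, then its pointwise
infimum is a Carathéodory solution of the two-point boundary value problem and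
is below every supersolution (hence minimal). -/
theorem inf_of_supersols_is_minimal_solution {m n : ℕ} (T : ℝ) (hT : 0 < T)
    (f : ℝ → (Fin m → ℝ) → (Fin n → ℝ) → Fin m → ℝ)
    (g : ℝ → (Fin m → ℝ) → (Fin n → ℝ) → Fin n → ℝ)
    (hfx : ∀ t x y (i k : Fin m), k ≠ i →
      Monotone (fun s => f t (Function.update x k s) y i))
    (hfy : ∀ t x y (i : Fin m) (j : Fin n),
      Monotone (fun s => f t x (Function.update y j s) i))
    (hgx : ∀ t x y (j : Fin n) (i : Fin m),
      Antitone (fun s => g t (Function.update x i s) y j))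
    (hgy : ∀ t x y (j k : Fin n), k ≠ j →
      Antitone (fun s => g t x (Function.update y k s) j))
    (hfcont : ∀ t, Continuous fun p : (Fin m → ℝ) × (Fin n → ℝ) => f t p.1 p.2)
    (hgcont : ∀ t, Continuous fun p : (Fin m → ℝ) × (Fin n → ℝ) => g t p.1 p.2)
    (hfmeas : ∀ x y, Measurable fun t => f t x y)
    (hgmeas : ∀ x y, Measurable fun t => g t x y)
    (hbdd : ∀ M > (0:ℝ), ∃ C, ∀ t ∈ Icc (0:ℝ) T, ∀ x y,
      (∀ i, |x i| ≤ M) → (∀ j, |y j| ≤ M) →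
      (∀ i, |f t x y i| ≤ C) ∧ (∀ j, |g t x y j| ≤ C))
    (xbar : Fin m → ℝ) (ybar : Fin n → ℝ)
    (hne : ∃ x y, IsSupersol T f g xbar ybar x y)
    (hbelow : ∃ C, ∀ x y, IsSupersol T f g xbar ybar x y →
      ∀ t ∈ Icc (0:ℝ) T, (∀ i, C ≤ x t i) ∧ (∀ j, C ≤ y t j))
    (xstar : ℝ → Fin m → ℝ) (ystar : ℝ → Fin n → ℝ)
    (hxstar : ∀ t i, xstar t i =
      sInf {v | ∃ x y, IsSupersol T f g xbar ybar x y ∧ v = x t i})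
    (hystar : ∀ t j, ystar t j =
      sInf {v | ∃ x y, IsSupersol T f g xbar ybar x y ∧ v = y t j}) :
    (∀ i, IntervalIntegrable (fun s => f s (xstar s) (ystar s) i) volume 0 T) ∧
    (∀ j, IntervalIntegrable (fun s => g s (xstar s) (ystar s) j) volume 0 T) ∧
    (∀ t ∈ Icc (0:ℝ) T, ∀ i,
      xstar t i = xbar i + ∫ s in (0:ℝ)..t, f s (xstar s) (ystar s) i) ∧
    (∀ t ∈ Icc (0:ℝ) T, ∀ j,
      ystar t j = ybar j - ∫ s in t..T, g s (xstar s) (ystar s) j) ∧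
    (∀ x y, IsSupersol T f g xbar ybar x y → ∀ t ∈ Icc (0:ℝ) T,
      (∀ i, xstar t i ≤ x t i) ∧ (∀ j, ystar t j ≤ y t j)) := by
  have H : Hyp T f g := ⟨hT, hfx, hfy, hgx, hgy, hfcont, hgcont, hfmeas, hgmeas, hbdd⟩
  have hrefl : ∀ t ∈ Icc (0:ℝ) T, T - t ∈ Icc (0:ℝ) T := fun t ht =>
    ⟨by linarith [ht.2], by linarith [ht.1]⟩
  have hmx : ∀ x y, IsSupersol T f g xbar ybar x y → ∀ t ∈ Icc (0:ℝ) T, ∀ i, xstar t i ≤ x t i := by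
    intro x y h t ht i
    rw [hxstar]
    obtain ⟨C, hC⟩ := hbelow
    refine csInf_le ⟨C, ?_⟩ ⟨x, y, h, rfl⟩
    rintro _ ⟨x, y, h, rfl⟩
    exact (hC x y h t ht).1 i
  have hmy : ∀ x y, IsSupersol T f g xbar ybar x y → ∀ t ∈ Icc (0:ℝ) T, ∀ i, ystar t i ≤ y t i := by
    intro x y h t ht i
    rw [hystar]
    obtain ⟨C, hC⟩ := hbelow
    refine csInf_le ⟨C, ?_⟩ ⟨x, y, h, rfl⟩
    rintro _ ⟨x, y, h, rfl⟩
    exact (hC x y h t ht).2 i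
  obtain ⟨x₀, y₀, h0⟩ := hne
  have hax : ∀ t ∈ Icc (0:ℝ) T, ∀ i, ∀ ε > 0, ∃ x y, IsSupersol T f g xbar ybar x y ∧
      x t i < xstar t i + ε := by
    intro t ht i ε hε
    rw [hxstar]
    obtain ⟨_, ⟨x, y, h, rfl⟩, hlt⟩ := Real.lt_sInf_add_pos (s := {v | ∃ x y, IsSupersol T f g xbar ybar x y ∧ v = x t i})
      ⟨_, x₀, y₀, h0, rfl⟩ hε
    exact ⟨x, y, h, hlt⟩
  have hay : ∀ t ∈ Icc (0:ℝ) T, ∀ i, ∀ ε > 0, ∃ x y, IsSupersol T f g xbar ybar x y ∧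
      y t i < ystar t i + ε := by
    intro t ht i ε hε
    rw [hystar]
    obtain ⟨_, ⟨x, y, h, rfl⟩, hlt⟩ := Real.lt_sInf_add_pos (s := {v | ∃ x y, IsSupersol T f g xbar ybar x y ∧ v = y t i})
      ⟨_, x₀, y₀, h0, rfl⟩ hε
    exact ⟨x, y, h, hlt⟩
  have hmy' : ∀ u w, IsSupersol T (fun t y x j => - g (T - t) x y j)
      (fun t y x i => - f (T - t) x y i) ybar xbar u w → ∀ t ∈ Icc (0:ℝ) T, ∀ i,
      ystar (T - t) i ≤ u t i := by
    intro u w h t ht i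
    have := hmy _ _ (h.unswap H) (T - t) (hrefl t ht) i
    simpa using this
  have hbelow' : ∃ C, ∀ u w, IsSupersol T (fun t y x j => - g (T - t) x y j)
      (fun t y x i => - f (T - t) x y i) ybar xbar u w →
      ∀ t ∈ Icc (0:ℝ) T, (∀ i, C ≤ u t i) ∧ (∀ j, C ≤ w t j) := by
    obtain ⟨C, hC⟩ := hbelow
    refine ⟨C, fun u w h t ht => ?_⟩
    have := hC _ _ (h.unswap H) (T - t) (hrefl t ht)
    simpa using this.symm
  obtain ⟨U₁, W₁, hS₁, hconv₁⟩ := seqhalf H h0 hbelow hmx hax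
  obtain ⟨U₂, W₂, hS₂, hconv₂⟩ := seqhalf H.swap (h0.swap H) hbelow'
    (xs := fun t => ystar (T - t)) hmy' (by
      intro t ht i ε hε
      obtain ⟨x, y, h, hlt⟩ := hay (T - t) (hrefl t ht) i ε hε
      exact ⟨_, _, h.swap H, hlt⟩)
  let X : ℕ → ℝ → Fin m → ℝ := fun l => itMin (itMin x₀ U₁ (l+1)) (fun k t => W₂ k (T - t)) (l+1)
  let Y : ℕ → ℝ → Fin n → ℝ := fun l => itMin (itMin y₀ W₁ (l+1)) (fun k t => U₂ k (T - t)) (l+1)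
  have hS : ∀ l, IsSupersol T f g xbar ybar (X l) (Y l) := fun l =>
    itMin_sup H (itMin_sup H h0 hS₁ (l+1)) (fun k => (hS₂ k).unswap H) (l+1)
  have hX0 : ∀ l, ∀ t ∈ Icc (0:ℝ) T, ∀ i, X l t i ≤ x₀ t i := fun l t _ i =>
    (itMin_le_base _ _ _ _ _).trans (itMin_le_base _ _ _ _ _)
  have hY0 : ∀ l, ∀ t ∈ Icc (0:ℝ) T, ∀ i, Y l t i ≤ y₀ t i := fun l t _ i =>
    (itMin_le_base _ _ _ _ _).trans (itMin_le_base _ _ _ _ _)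
  have hX : ∀ t ∈ Icc (0:ℝ) T, ∀ i, Tendsto (fun l => X l t i) atTop (𝓝 (xstar t i)) :=
    hconv₁ X Y hS hX0 hY0 fun l k hk t _ i =>
      (itMin_le_base _ _ _ _ _).trans (itMin_le _ _ _ _ (by omega) _ _)
  have hY' : ∀ t ∈ Icc (0:ℝ) T, ∀ i, Tendsto (fun l => Y l (T - t) i) atTop (𝓝 (ystar (T - t) i)) :=
    hconv₂ (fun l t => Y l (T - t)) (fun l t => X l (T - t)) (fun l => (hS l).swap H)
      (fun l t ht i => hY0 l _ (hrefl t ht) i) (fun l t ht i => hX0 l _ (hrefl t ht) i)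
      fun l k hk t _ i => by
        have := itMin_le (itMin y₀ W₁ (l+1)) (fun k t => U₂ k (T - t)) (l+1) k (by omega) (T - t) i
        simpa [Y] using this
  have hY : ∀ t ∈ Icc (0:ℝ) T, ∀ i, Tendsto (fun l => Y l t i) atTop (𝓝 (ystar t i)) := by
    intro t ht i
    have := hY' (T - t) (hrefl t ht) i
    simpa using this
  obtain ⟨M, -, hM⟩ := sup_bdd H h0 hbelow
  have hXM := fun l => (hM _ _ (hS l) (hX0 l) (hY0 l)).1
  have hYM := fun l => (hM _ _ (hS l) (hX0 l) (hY0 l)).2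
  have A := half H X Y hS M hXM hYM xstar ystar hX hY hmx
  have B := half H.swap (fun l t => Y l (T - t)) (fun l t => X l (T - t)) (fun l => (hS l).swap H) M
    (fun l t ht i => hYM l _ (hrefl t ht) i) (fun l t ht i => hXM l _ (hrefl t ht) i)
    (fun t => ystar (T - t)) (fun t => xstar (T - t)) hY' (fun t ht i => hX _ (hrefl t ht) i) hmy'
  refine ⟨fun i => (A i).1, fun j => ?_, fun t ht i => (A i).2 t ht, fun t ht j => ?_,
    fun x y h t ht => ⟨hmx x y h t ht, hmy x y h t ht⟩⟩
  · have := ((B j).1.comp_sub_left T).symm.neg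
    simpa [Pi.neg_def] using this
  · have := (B j).2 (T - t) (hrefl t ht)
    simp only [intervalIntegral.integral_neg,
      intervalIntegral.integral_comp_sub_left (fun s => g s (xstar s) (ystar s) j), sub_zero,
      sub_sub_cancel] at this
    linarith
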